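/- There exist real numbers c > 0, α > 0 and N such that the growth function γ of the Grigorchuk group G with respect to the generating set {a, b, c, d} satisfies γ(n) ≥ exp(c·n^α) for all n ≥ N; in particular (ln γ(n))/(ln n) → ∞ as n → ∞, so G has superpolynomial growth. -/

import Mathlib

namespace Grig

def aFun : List Bool → List Bool
  | [] => []
  | x :: v => (!x) :: v

mutual
  def bFun : List Bool → List Bool
    | [] => []
    | false :: v => false :: aFun v
    | true :: v => true :: cFun v
  def cFun : List Bool → List Bool
    | [] => []
    | false :: v => false :: aFun v
    | true :: v => true :: dFun v
  def dFun : List Bool → List Bool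
    | [] => []
    | false :: v => false :: v
    | true :: v => true :: bFun v
end

theorem aFun_invol : Function.Involutive aFun := by
  intro v; cases v <;> simp [aFun]

theorem bcd_invol : ∀ v, bFun (bFun v) = v ∧ cFun (cFun v) = v ∧ dFun (dFun v) = v := by
  intro v
  induction v with
  | nil => simp [bFun, cFun, dFun]
  | cons x v ih =>
    cases x <;> simp [bFun, cFun, dFun, aFun_invol v, ih.1, ih.2.1, ih.2.2]

/-- The automorphism `a` of the binary tree. -/
def a : Equiv.Perm (List Bool) := Function.Involutive.toPerm aFun aFun_invol

def b : Equiv.Perm (List Bool) := Function.Involutive.toPerm bFun (fun v => (bcd_invol v).1)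

def c : Equiv.Perm (List Bool) := Function.Involutive.toPerm cFun (fun v => (bcd_invol v).2.1)

def d : Equiv.Perm (List Bool) := Function.Involutive.toPerm dFun (fun v => (bcd_invol v).2.2)

/-- The Grigorchuk group, as the subgroup generated by `a, b, c, d` inside the
permutation group of the vertex set of the binary tree. -/
def grigG : Subgroup (Equiv.Perm (List Bool)) := Subgroup.closure {a, b, c, d}

end Grig

namespace Grig

/-- The growth function of the Grigorchuk group with respect to `{a, b, c, d}`: the number
of elements that are products of at most `n` elements of `{a, b, c, d}`. -/
noncomputable def grigGrowth (n : ℕ) : ℕ :=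
  Nat.card {g : Equiv.Perm (List Bool) |
    ∃ l : List (Equiv.Perm (List Bool)), l.length ≤ n ∧
      (∀ x ∈ l, x ∈ ({a, b, c, d} : Set (Equiv.Perm (List Bool)))) ∧ l.prod = g}

end Grig

namespace Grig


/-- Letters of the alphabet, and their values. -/
def gen : Fin 4 → Equiv.Perm (List Bool) := ![a, b, c, d]

/-- Value of a word in the generators. -/
def ev (w : List (Fin 4)) : Equiv.Perm (List Bool) := (w.map gen).prod

/-- The substitution `a ↦ aca, b ↦ d, c ↦ b, d ↦ c`. -/
def sub : Fin 4 → List (Fin 4) := ![[0, 2, 0], [3], [1], [2]]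

/-- The left section of the substitution. -/
def lft : Fin 4 → Equiv.Perm (List Bool) := ![d, 1, a, a]

def sig (w : List (Fin 4)) : List (Fin 4) := w.flatMap sub

def lf (w : List (Fin 4)) : Equiv.Perm (List Bool) := (w.map lft).prod

theorem a_val (v : List Bool) : a v = aFun v := rfl
theorem b_val (v : List Bool) : b v = bFun v := rfl
theorem c_val (v : List Bool) : c v = cFun v := rfl
theorem d_val (v : List Bool) : d v = dFun v := rfl
theorem a_apply (x : Bool) (v : List Bool) : a (x :: v) = (!x) :: v := by
  simp [a_val, aFun]
theorem b_f (v : List Bool) : b (false :: v) = false :: a v := by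
  simp [a_val, b_val, bFun]
theorem b_t (v : List Bool) : b (true :: v) = true :: c v := by
  simp [b_val, c_val, bFun]
theorem c_f (v : List Bool) : c (false :: v) = false :: a v := by
  simp [a_val, c_val, cFun]
theorem c_t (v : List Bool) : c (true :: v) = true :: d v := by
  simp [d_val, c_val, cFun]
theorem d_f (v : List Bool) : d (false :: v) = false :: v := by
  simp [d_val, dFun]
theorem d_t (v : List Bool) : d (true :: v) = true :: b v := by
  simp [b_val, d_val, dFun]
theorem a_nil : a [] = [] := by simp [a_val, aFun]
theorem b_nil : b [] = [] := by simp [b_val, bFun]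
theorem c_nil : c [] = [] := by simp [c_val, cFun]
theorem d_nil : d [] = [] := by simp [d_val, dFun]

theorem ev_nil : ev [] = 1 := rfl
theorem ev_cons (x : Fin 4) (w : List (Fin 4)) : ev (x :: w) = gen x * ev w := by
  simp [ev]
theorem ev_append (u w : List (Fin 4)) : ev (u ++ w) = ev u * ev w := by
  simp [ev]
theorem sig_cons (x : Fin 4) (w : List (Fin 4)) : sig (x :: w) = sub x ++ sig w := by
  simp [sig]
theorem lf_cons (x : Fin 4) (w : List (Fin 4)) : lf (x :: w) = lft x * lf w := by
  simp [lf]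

theorem sub_t (x : Fin 4) (v : List Bool) : ev (sub x) (true :: v) = true :: gen x v := by
  fin_cases x <;> simp [sub, ev, gen, a_apply, b_t, c_t, d_t, c_f]

theorem sub_f (x : Fin 4) (v : List Bool) : ev (sub x) (false :: v) = false :: lft x v := by
  fin_cases x <;> simp [sub, ev, gen, lft, a_apply, b_f, c_t, d_f, c_f]

theorem sig_t (w : List (Fin 4)) (v : List Bool) :
    ev (sig w) (true :: v) = true :: ev w v := by
  induction w with
  | nil => rfl
  | cons x w ih =>
    rw [sig_cons, ev_append, ev_cons, Equiv.Perm.mul_apply, ih, sub_t, Equiv.Perm.mul_apply]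

theorem sig_f (w : List (Fin 4)) (v : List Bool) :
    ev (sig w) (false :: v) = false :: lf w v := by
  induction w with
  | nil => rfl
  | cons x w ih =>
    rw [sig_cons, ev_append, lf_cons, Equiv.Perm.mul_apply, ih, sub_f, Equiv.Perm.mul_apply]

theorem sig_length (w : List (Fin 4)) : (sig w).length ≤ 3 * w.length := by
  induction w with
  | nil => simp [sig]
  | cons x w ih =>
    have : (sub x).length ≤ 3 := by fin_cases x <;> simp [sub]
    rw [sig_cons, List.length_append, List.length_cons]; omega

theorem a_sq : a * a = 1 := by
  ext1 v; simpa [a_val] using aFun_invol v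
theorem d_sq : d * d = 1 := by
  ext1 v; simpa [d_val] using (bcd_invol v).2.2

theorem adad : d * (a * (d * a)) = a * (d * (a * d)) := by
  ext1 v
  rcases v with _ | ⟨x, v⟩
  · simp [a_nil, d_nil]
  · cases x <;> simp [a_apply, d_f, d_t]

/-- The dihedral group generated by `a` and `d`, listed. -/
def dih : List (Equiv.Perm (List Bool)) :=
  [1, a, d, a * d, d * a, a * (d * a), d * (a * d), a * (d * (a * d))]

theorem aa_mul (g : Equiv.Perm (List Bool)) : a * (a * g) = g := by
  rw [← mul_assoc, a_sq, one_mul]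
theorem dd_mul (g : Equiv.Perm (List Bool)) : d * (d * g) = g := by
  rw [← mul_assoc, d_sq, one_mul]

theorem dih_a (g : Equiv.Perm (List Bool)) (h : g ∈ dih) : a * g ∈ dih := by
  simp only [dih, List.mem_cons, List.not_mem_nil, or_false] at h
  rcases h with h | h | h | h | h | h | h | h <;> subst h <;> simp [dih, aa_mul, a_sq]

theorem dih_d (g : Equiv.Perm (List Bool)) (h : g ∈ dih) : d * g ∈ dih := by
  simp only [dih, List.mem_cons, List.not_mem_nil, or_false] at h
  rcases h with h | h | h | h | h | h | h | h <;> subst h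
  · simp [dih]
  · simp [dih]
  · simp [dih, d_sq]
  · simp [dih]
  · simp [dih, dd_mul]
  · simp [dih, adad]
  · simp [dih, dd_mul]
  · rw [← adad, dd_mul]; simp [dih]

theorem lf_mem (w : List (Fin 4)) : lf w ∈ dih := by
  induction w with
  | nil => simp [lf, dih]
  | cons x w ih =>
    rw [lf_cons]
    fin_cases x
    · exact dih_d _ ih
    · simpa [lft] using ih
    · exact dih_a _ ih
    · exact dih_a _ ih

/-- The pairing word. -/
def pw (u w : List (Fin 4)) : List (Fin 4) := sig u ++ 0 :: (sig w ++ [0])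

theorem pw_length (u w : List (Fin 4)) : (pw u w).length ≤ 3 * u.length + 3 * w.length + 2 := by
  have := sig_length u
  have := sig_length w
  simp only [pw, List.length_append, List.length_cons, List.length_nil]
  omega

theorem pw_t (u w : List (Fin 4)) (v : List Bool) :
    ev (pw u w) (true :: v) = true :: ev u (lf w v) := by
  have h0 : gen 0 = a := rfl
  simp [pw, ev_append, ev_cons, ev_nil, h0, a_apply, sig_t, sig_f]

theorem pw_f (u w : List (Fin 4)) (v : List Bool) :
    ev (pw u w) (false :: v) = false :: lf u (ev w v) := by
  have h0 : gen 0 = a := rfl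
  simp [pw, ev_append, ev_cons, ev_nil, h0, a_apply, sig_t, sig_f]

theorem pw_inj (u w u' w' : List (Fin 4)) (h : ev (pw u w) = ev (pw u' w'))
    (hu : lf u = lf u') (hw : lf w = lf w') : ev u = ev u' ∧ ev w = ev w' := by
  constructor
  · have : ev u * lf w = ev u' * lf w' := by
      ext1 v
      have := congrArg (fun g => g (true :: v)) h
      simpa [pw_t] using this
    rw [hw] at this
    exact mul_right_cancel this
  · have : lf u * ev w = lf u' * ev w' := by
      ext1 v
      have := congrArg (fun g => g (false :: v)) h
      simpa [pw_f] using this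
    rw [hu] at this
    exact mul_left_cancel this

/-- The ball. -/
def ball (n : ℕ) : Set (Equiv.Perm (List Bool)) := {g | ∃ w, w.length ≤ n ∧ ev w = g}

theorem gen_surj (x : Equiv.Perm (List Bool))
    (h : x ∈ ({a, b, c, d} : Set (Equiv.Perm (List Bool)))) : ∃ i, gen i = x := by
  simp only [Set.mem_insert_iff, Set.mem_singleton_iff] at h
  rcases h with h | h | h | h
  · exact ⟨0, h.symm⟩
  · exact ⟨1, h.symm⟩
  · exact ⟨2, h.symm⟩
  · exact ⟨3, h.symm⟩

theorem gen_mem (i : Fin 4) : gen i ∈ ({a, b, c, d} : Set (Equiv.Perm (List Bool))) := by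
  fin_cases i <;> simp [gen]

theorem growth_eq (n : ℕ) : grigGrowth n = (ball n).ncard := by
  rw [grigGrowth, ← Nat.card_coe_set_eq]
  congr 2
  ext g
  constructor
  · rintro ⟨l, hl, hm, rfl⟩
    have : ∃ w : List (Fin 4), w.map gen = l := by
      have : l ∈ Set.range (List.map gen) := by
        rw [Set.range_list_map]
        exact fun x hx => gen_surj x (hm x hx)
      exact this
    obtain ⟨w, rfl⟩ := this
    exact ⟨w, by simpa using hl, rfl⟩
  · rintro ⟨w, hl, rfl⟩
    refine ⟨w.map gen, by simpa using hl, ?_, rfl⟩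
    intro x hx
    obtain ⟨i, _, rfl⟩ := List.mem_map.1 hx
    exact gen_mem i

theorem ball_finite (n : ℕ) : (ball n).Finite := by
  have h : {w : List (Fin 4) | w.length ≤ n}.Finite := List.finite_length_le _ _
  refine (h.image ev).subset ?_
  rintro g ⟨w, hw, rfl⟩
  exact ⟨w, hw, rfl⟩

theorem ball_mono {m n : ℕ} (h : m ≤ n) : ball m ⊆ ball n := by
  rintro g ⟨w, hw, rfl⟩
  exact ⟨w, hw.trans h, rfl⟩

theorem growth_mono {m n : ℕ} (h : m ≤ n) : grigGrowth m ≤ grigGrowth n := by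
  rw [growth_eq, growth_eq]
  exact Set.ncard_le_ncard (ball_mono h) (ball_finite n)

theorem growth_step (n : ℕ) : grigGrowth n ^ 2 ≤ 64 * grigGrowth (6 * n + 2) := by
  classical
  have hch : ∀ g : Equiv.Perm (List Bool), ∃ w : List (Fin 4), g ∈ ball n →
      w.length ≤ n ∧ ev w = g := by
    intro g
    by_cases hg : g ∈ ball n
    · obtain ⟨w, hw⟩ := hg
      exact ⟨w, fun _ => hw⟩
    · exact ⟨[], fun h => absurd h hg⟩
  choose W hW using hch
  set B := (ball_finite n).toFinset with hB
  set B' := (ball_finite (6 * n + 2)).toFinset with hB'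
  have hc : (B ×ˢ B).card ≤ ((dih.toFinset ×ˢ dih.toFinset) ×ˢ B').card := by
    apply Finset.card_le_card_of_injOn
      (fun p => ((lf (W p.1), lf (W p.2)), ev (pw (W p.1) (W p.2))))
    · rintro ⟨g, h⟩ hp
      simp only [hB, Finset.coe_product, Set.mem_prod, Set.Finite.coe_toFinset] at hp
      have h1 := hW g hp.1
      have h2 := hW h hp.2
      have := pw_length (W g) (W h)
      simp only [hB', Finset.coe_product, Set.mem_prod, Set.Finite.coe_toFinset,
        List.coe_toFinset, Set.mem_ofPred_eq]
      exact ⟨⟨lf_mem _, lf_mem _⟩, pw (W g) (W h), by omega, rfl⟩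
    · rintro ⟨g, h⟩ hp ⟨g', h'⟩ hp' he
      simp only [hB, Finset.coe_product, Set.mem_prod, Set.Finite.coe_toFinset] at hp hp'
      simp only [Prod.mk.injEq] at he
      have := pw_inj _ _ _ _ he.2 he.1.1 he.1.2
      rw [(hW g hp.1).2, (hW h hp.2).2, (hW g' hp'.1).2, (hW h' hp'.2).2] at this
      exact Prod.ext this.1 this.2
  have hd : dih.toFinset.card ≤ 8 := (List.toFinset_card_le dih).trans (by simp [dih])
  have e1 : B.card = grigGrowth n := by
    rw [growth_eq, Set.ncard_eq_toFinset_card _ (ball_finite n)]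
  have e2 : B'.card = grigGrowth (6 * n + 2) := by
    rw [growth_eq, Set.ncard_eq_toFinset_card _ (ball_finite _)]
  rw [Finset.card_product, Finset.card_product, Finset.card_product, e1, e2] at hc
  calc grigGrowth n ^ 2 = grigGrowth n * grigGrowth n := sq _
    _ ≤ _ := hc
    _ ≤ 8 * 8 * grigGrowth (6 * n + 2) := by gcongr
    _ = _ := by norm_num

theorem trans (v : List Bool) :
    ∃ w : List (Fin 4), ev w v = List.replicate v.length true := by
  induction v with
  | nil => exact ⟨[], rfl⟩
  | cons x v ih =>
    obtain ⟨w, hw⟩ := ih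
    cases x
    · refine ⟨sig w ++ [0], ?_⟩
      have h0 : gen 0 = a := rfl
      simp [ev_append, ev_cons, ev_nil, h0, a_apply, sig_t, hw, List.replicate_succ]
    · exact ⟨sig w, by simp [sig_t, hw, List.replicate_succ]⟩

theorem growth_base : ∃ n, 1 ≤ n ∧ 128 ≤ grigGrowth n := by
  classical
  choose w hw using trans
  let S : Finset (List.Vector Bool 7) := Finset.univ
  let m := S.sup (fun v => (w v.1).length)
  refine ⟨m + 1, by omega, ?_⟩
  have hc : S.card ≤ (ball_finite (m + 1)).toFinset.card := by
    apply Finset.card_le_card_of_injOn (fun v => ev (w v.1))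
    · intro v _
      simp only [Set.Finite.coe_toFinset]
      have : (w v.1).length ≤ m := Finset.le_sup (f := fun v : List.Vector Bool 7 => (w v.1).length)
        (Finset.mem_univ v)
      exact ⟨w v.1, by omega, rfl⟩
    · intro v _ u _ h
      have h1 := hw v.1
      have h2 := hw u.1
      rw [v.2] at h1
      rw [u.2, ← h1] at h2
      simp only at h
      rw [h] at h2
      exact Subtype.ext ((ev (w u.1)).injective h2).symm
  have hS : S.card = 128 := by
    rw [Finset.card_univ, card_vector]; rfl
  rw [growth_eq, Set.ncard_eq_toFinset_card _ (ball_finite _), ← hS]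
  exact hc

theorem growth_iter (m : ℕ) (hm : 1 ≤ m) (h : 128 ≤ grigGrowth m) (k : ℕ) :
    64 * 2 ^ (2 ^ k) ≤ grigGrowth (8 ^ k * m) := by
  induction k with
  | zero => simpa using h
  | succ k ih =>
    have h1 := growth_step (8 ^ k * m)
    have h2 : grigGrowth (6 * (8 ^ k * m) + 2) ≤ grigGrowth (8 ^ (k + 1) * m) := by
      apply growth_mono
      have : 1 ≤ 8 ^ k * m := Nat.mul_pos (by positivity) hm
      rw [pow_succ]; nlinarith
    have h3 := Nat.pow_le_pow_left ih 2
    have h4 : (2 : ℕ) ^ (2 ^ (k + 1)) = (2 ^ (2 ^ k)) ^ 2 := by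
      rw [← pow_mul, pow_succ 2 k]
    rw [h4]
    nlinarith

theorem main_bound : ∃ c α : ℝ, 0 < c ∧ 0 < α ∧ ∃ N : ℕ, ∀ n, N ≤ n →
      Real.exp (c * (n : ℝ) ^ α) ≤ (grigGrowth n : ℝ) := by
  obtain ⟨m, hm, hg⟩ := growth_base
  have hm0 : (0 : ℝ) < 8 * m := by positivity
  refine ⟨Real.log 2 / (8 * m : ℝ) ^ (1 / 3 : ℝ), 1 / 3,
    div_pos (Real.log_pos (by norm_num)) (by positivity), by norm_num, m, fun n hn => ?_⟩
  have hq : n / m ≠ 0 := (Nat.div_pos hn hm).ne'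
  set k := Nat.log 8 (n / m) with hk
  have k1 : 8 ^ k ≤ n / m := Nat.pow_log_le_self 8 hq
  have k2 : n / m < 8 ^ (k + 1) := Nat.lt_pow_succ_log_self (by norm_num) _
  have k1' : 8 ^ k * m ≤ n := (Nat.le_div_iff_mul_le hm).1 k1
  have k2' : n < 8 ^ (k + 1) * m := (Nat.div_lt_iff_lt_mul hm).1 k2
  have h1 : (2 : ℕ) ^ (2 ^ k) ≤ grigGrowth n :=
    le_trans (by have := Nat.zero_le ((2 : ℕ) ^ (2 ^ k)); omega)
      ((growth_iter m hm hg k).trans (growth_mono k1'))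
  have h2 : (n : ℝ) ^ (1 / 3 : ℝ) ≤ 2 ^ k * (8 * m : ℝ) ^ (1 / 3 : ℝ) := by
    have e : (2 : ℝ) ^ k = ((8 : ℝ) ^ k) ^ (1 / 3 : ℝ) := by
      have : (8 : ℝ) ^ k = ((2 : ℝ) ^ k) ^ (3 : ℝ) := by
        have : (3 : ℝ) = ((3 : ℕ) : ℝ) := by norm_num
        rw [this, Real.rpow_natCast, ← pow_mul, mul_comm, pow_mul]; norm_num
      rw [this, ← Real.rpow_mul (by positivity)]; norm_num
    rw [e, ← Real.mul_rpow (by positivity) (by positivity)]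
    apply Real.rpow_le_rpow (by positivity) _ (by norm_num)
    have : (n : ℝ) < 8 ^ (k + 1) * m := by exact_mod_cast k2'
    rw [pow_succ] at this; linarith
  have h3 : Real.log 2 / (8 * m : ℝ) ^ (1 / 3 : ℝ) * (n : ℝ) ^ (1 / 3 : ℝ) ≤
      (2 ^ k : ℕ) * Real.log 2 := by
    have hp : 0 < (8 * m : ℝ) ^ (1 / 3 : ℝ) := by positivity
    rw [div_mul_eq_mul_div, div_le_iff₀ hp]
    have := mul_le_mul_of_nonneg_left h2 (Real.log_nonneg (by norm_num : (1 : ℝ) ≤ 2))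
    push_cast
    linarith
  calc _ ≤ Real.exp ((2 ^ k : ℕ) * Real.log 2) := Real.exp_le_exp.2 h3
    _ = (2 : ℝ) ^ (2 ^ k) := by
      rw [Real.exp_nat_mul, Real.exp_log (by norm_num)]
    _ ≤ _ := by exact_mod_cast h1

/-- The Grigorchuk group has superpolynomial growth: `γ(n) ≥ exp (c n^α)` for some
`c, α > 0` and all sufficiently large `n`; in particular `ln γ(n) / ln n → ∞`. -/
theorem grigG_superpolynomial_growth :
    (∃ c α : ℝ, 0 < c ∧ 0 < α ∧ ∃ N : ℕ, ∀ n, N ≤ n →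
      Real.exp (c * (n : ℝ) ^ α) ≤ (grigGrowth n : ℝ)) ∧
    Filter.Tendsto (fun n : ℕ => Real.log (grigGrowth n) / Real.log n)
      Filter.atTop Filter.atTop := by
  refine ⟨main_bound, ?_⟩
  obtain ⟨c, α, hc, hα, N, hN⟩ := main_bound
  have ho : Filter.Tendsto (fun x : ℝ => x ^ α / Real.log x) Filter.atTop Filter.atTop := by
    have h1 := (isLittleO_log_rpow_atTop hα).tendsto_div_nhds_zero
    have h2 : Filter.Tendsto (fun x : ℝ => Real.log x / x ^ α) Filter.atTop
        (nhdsWithin 0 (Set.Ioi 0)) := by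
      refine tendsto_nhdsWithin_iff.2 ⟨h1, ?_⟩
      filter_upwards [Filter.eventually_gt_atTop 1] with x hx
      have : 0 < x := by linarith
      exact div_pos (Real.log_pos hx) (by positivity)
    refine h2.inv_tendsto_nhdsGT_zero.congr (fun x => ?_)
    simp
  have h2 := (ho.comp (tendsto_natCast_atTop_atTop (R := ℝ))).const_mul_atTop hc
  refine Filter.tendsto_atTop_mono' _ ?_ h2
  filter_upwards [Filter.eventually_ge_atTop N, Filter.eventually_ge_atTop 2] with n h3 h4
  have hl : 0 < Real.log n := Real.log_pos (by exact_mod_cast h4)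
  have := Real.log_le_log (Real.exp_pos _) (hN n h3)
  rw [Real.log_exp] at this
  simp only [Function.comp_apply]
  rw [← mul_div_assoc]
  gcongr

end Grig
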